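/- Let K be the state space of a complete order unit space (V, V₊, v) with V ≠ 0, and identify each x ∈ V with the continuous affine function ρ ↦ ρ(x) on K, so that the open cone C := V₊° corresponds to the set of strictly positive continuous affine functions on K. Then: (1) for every affine upper semicontinuous g: K → [0,∞), the set 𝔄 := {a ∈ C : a(σ) > g(σ) for all σ ∈ K} is downward directed (for a₁, a₂ ∈ 𝔄 there is a ∈ 𝔄 with a ≤ a₁ and a ≤ a₂) and g(ρ) = inf{a(ρ) : a ∈ 𝔄} for every ρ ∈ K; (2) for every affine lower semicontinuous h: K → (0,∞], the set 𝔅 := {b ∈ C : b(σ) < h(σ) for all σ ∈ K} is upward directed and h(ρ) = sup{b(ρ) : b ∈ 𝔅} for every ρ ∈ K. -/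

import Mathlib

open scoped Topology

section Defs

/-- `(V, P, v)` is an order unit space: `P` is a proper cone, the induced order is
archimedean, `v` is an order unit, and the norm of `V` is the order unit norm. -/
structure IsOrderUnitSpace (V : Type*) [NormedAddCommGroup V] [NormedSpace ℝ V]
    (P : Set V) (v : V) : Prop where
  add_mem : ∀ x ∈ P, ∀ y ∈ P, x + y ∈ P
  smul_mem : ∀ r : ℝ, 0 ≤ r → ∀ x ∈ P, r • x ∈ P
  proper : ∀ x : V, x ∈ P → -x ∈ P → x = 0
  archimedean : ∀ x b : V, (∀ r : ℝ, 0 ≤ r → b - r • x ∈ P) → -x ∈ P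
  unit_mem : v ∈ P
  unit_order : ∀ x : V, ∃ r : ℝ, 0 < r ∧ r • v - x ∈ P
  norm_eq : ∀ x : V, ‖x‖ = sInf {r : ℝ | 0 ≤ r ∧ x + r • v ∈ P ∧ r • v - x ∈ P}

variable {V : Type*} [NormedAddCommGroup V] [NormedSpace ℝ V]
variable {W : Type*} [NormedAddCommGroup W] [NormedSpace ℝ W]

/-- The open cone (norm interior of the cone `P`) of an order unit space. -/
def openCone (P : Set V) (v : V) : Set V := {x | ∃ ε : ℝ, 0 < ε ∧ x - ε • v ∈ P}

/-- The order unit norm `‖x‖_u` determined by an order unit `u`. -/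
noncomputable def ounorm (P : Set V) (u x : V) : ℝ :=
  sInf {r : ℝ | 0 ≤ r ∧ x + r • u ∈ P ∧ r • u - x ∈ P}

/-- Thompson's metric `d_T(x,y) = log inf {r ≥ 1 : r⁻¹ y ≤ x ≤ r y}`. -/
noncomputable def thompsonDist (P : Set V) (x y : V) : ℝ :=
  Real.log (sInf {r : ℝ | 1 ≤ r ∧ x - r⁻¹ • y ∈ P ∧ r • y - x ∈ P})

/-- `Φ` is a gauge-reversing bijection from the open cone of `(V, P, v)` onto the
open cone of `(W, Q, w)`: a bijection, homogeneous of degree `-1`,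
and an order-anti-isomorphism. -/
def GaugeReversing (P : Set V) (v : V) (Q : Set W) (w : W) (Φ : V → W) : Prop :=
  Set.BijOn Φ (openCone P v) (openCone Q w) ∧
  (∀ x ∈ openCone P v, ∀ r : ℝ, 0 < r → Φ (r • x) = r⁻¹ • Φ x) ∧
  (∀ x ∈ openCone P v, ∀ y ∈ openCone P v, (y - x ∈ P ↔ Φ x - Φ y ∈ Q))

/-- `Φ` is a gauge-preserving bijection from the open cone of `(V, P, v)` onto the
open cone of `(W, Q, w)`: a bijection, homogeneous of degree `1`,
and an order-isomorphism. -/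
def GaugePreserving (P : Set V) (v : V) (Q : Set W) (w : W) (Φ : V → W) : Prop :=
  Set.BijOn Φ (openCone P v) (openCone Q w) ∧
  (∀ x ∈ openCone P v, ∀ r : ℝ, 0 < r → Φ (r • x) = r • Φ x) ∧
  (∀ x ∈ openCone P v, ∀ y ∈ openCone P v, (y - x ∈ P ↔ Φ y - Φ x ∈ Q))

/-- `mul` is a JB-algebra structure on the order unit space `(V, P, v)` with unit
element `v` and cone of squares `P`. -/
def IsJBAlgebraStructure (P : Set V) (v : V) (mul : V →ₗ[ℝ] V →ₗ[ℝ] V) : Prop :=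
  (∀ x y : V, mul x y = mul y x) ∧
  (∀ x : V, mul v x = x) ∧
  (∀ x y : V, mul x (mul y (mul x x)) = mul (mul x y) (mul x x)) ∧
  (∀ x y : V, ‖mul x y‖ ≤ ‖x‖ * ‖y‖) ∧
  (∀ x : V, ‖mul x x‖ = ‖x‖ ^ 2) ∧
  (∀ x y : V, ‖mul x x‖ ≤ ‖mul x x + mul y y‖) ∧
  P = {y : V | ∃ x : V, mul x x = y}

/-- `S` is a `d_T`-symmetry of the open cone of `(V, P, v)` at the point `p`:
an involutive `d_T`-isometry of the open cone having `p` as an isolated fixed point. -/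
def IsDTSymmetry (P : Set V) (v : V) (S : V → V) (p : V) : Prop :=
  (∀ x ∈ openCone P v, S x ∈ openCone P v) ∧
  (∀ x ∈ openCone P v, S (S x) = x) ∧
  (∀ x ∈ openCone P v, ∀ y ∈ openCone P v,
    thompsonDist P (S x) (S y) = thompsonDist P x y) ∧
  p ∈ openCone P v ∧ S p = p ∧
  (∃ ε : ℝ, 0 < ε ∧ ∀ x ∈ openCone P v, S x = x → thompsonDist P p x < ε → x = p)

/-- A complete order unit space `(W, Q, w)` together with a gauge-reversing bijection
from the open cone of `(V, P, v)` onto the open cone of `(W, Q, w)`. -/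
structure GaugeReversingTarget (V : Type*) [NormedAddCommGroup V] [NormedSpace ℝ V]
    (P : Set V) (v : V) where
  W : Type
  [instGroup : NormedAddCommGroup W]
  [instSpace : NormedSpace ℝ W]
  [instComplete : CompleteSpace W]
  Q : Set W
  w : W
  ous : IsOrderUnitSpace W Q w
  Φ : V → W
  grev : GaugeReversing P v Q w Φ

/-- The state space of the order unit space `(V, P, v)`, as a subset of the
weak-* dual of `V`. -/
def stateSpace (P : Set V) (v : V) : Set (WeakDual ℝ V) :=
  {ρ | (∀ x ∈ P, 0 ≤ ρ x) ∧ ρ v = 1}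

/-- A real-valued function on the dual is affine on `K`. -/
def AffineOnK (K : Set (WeakDual ℝ V)) (g : WeakDual ℝ V → ℝ) : Prop :=
  ∀ ρ ∈ K, ∀ σ ∈ K, ∀ t : ℝ, 0 ≤ t → t ≤ 1 →
    g ((1 - t) • ρ + t • σ) = (1 - t) * g ρ + t * g σ

/-- An extended-real-valued function on the dual is affine on `K`. -/
def AffineOnKE (K : Set (WeakDual ℝ V)) (g : WeakDual ℝ V → EReal) : Prop :=
  ∀ ρ ∈ K, ∀ σ ∈ K, ∀ t : ℝ, 0 ≤ t → t ≤ 1 →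
    g ((1 - t) • ρ + t • σ) = ((1 - t : ℝ) : EReal) * g ρ + ((t : ℝ) : EReal) * g σ

/-- Membership in the extended cone `C_usc` of nonnegative affine upper semicontinuous
functions on the state space `K`. -/
def memCusc (K : Set (WeakDual ℝ V)) (g : WeakDual ℝ V → ℝ) : Prop :=
  (∀ ρ ∈ K, 0 ≤ g ρ) ∧ AffineOnK K g ∧ UpperSemicontinuousOn g K

/-- `p` is an extremal vector of the cone `C_usc` over the state space `K`. -/
def IsExtremalCusc (K : Set (WeakDual ℝ V)) (p : WeakDual ℝ V → ℝ) : Prop :=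
  memCusc K p ∧ (∃ ρ ∈ K, p ρ ≠ 0) ∧
  ∀ x, memCusc K x → (∀ ρ ∈ K, x ρ ≤ p ρ) →
    ∃ t : ℝ, 0 ≤ t ∧ t ≤ 1 ∧ ∀ ρ ∈ K, x ρ = t * p ρ

/-- The cone `C_usc` over the state space `K` is strongly atomic: each of its
members is the least upper bound of the extremal vectors it dominates. -/
def StronglyAtomicCusc (K : Set (WeakDual ℝ V)) : Prop :=
  ∀ g, memCusc K g →
    (∀ p, IsExtremalCusc K p → (∀ ρ ∈ K, p ρ ≤ g ρ) → ∀ ρ ∈ K, p ρ ≤ g ρ) ∧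
    (∀ h, memCusc K h →
      (∀ p, IsExtremalCusc K p → (∀ ρ ∈ K, p ρ ≤ g ρ) → ∀ ρ ∈ K, p ρ ≤ h ρ) →
      ∀ ρ ∈ K, g ρ ≤ h ρ)

end Defs

/-- The net of elements of the open cone lying strictly above an affine
upper semicontinuous function `g` on the state space. -/
def approxFromAbove {V : Type*} [NormedAddCommGroup V] [NormedSpace ℝ V]
    (P : Set V) (v : V) (g : WeakDual ℝ V → ℝ) : Set V :=
  {a : V | a ∈ openCone P v ∧ ∀ σ ∈ stateSpace P v, g σ < σ a}

/-- The net of elements of the open cone lying strictly below an affine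
lower semicontinuous function `h` on the state space. -/
def approxFromBelow {V : Type*} [NormedAddCommGroup V] [NormedSpace ℝ V]
    (P : Set V) (v : V) (h : WeakDual ℝ V → EReal) : Set V :=
  {b : V | b ∈ openCone P v ∧ ∀ σ ∈ stateSpace P v, ((σ b : ℝ) : EReal) < h σ}

theorem isCompact_convexJoin {E : Type*} [AddCommGroup E] [Module ℝ E] [TopologicalSpace E]
    [ContinuousAdd E] [ContinuousSMul ℝ E] {s t : Set E} (hs : IsCompact s) (ht : IsCompact t) :
    IsCompact (convexJoin ℝ s t) := by
  have hc : Continuous fun p : (E × E) × ℝ => (1 - p.2) • p.1.1 + p.2 • p.1.2 := by fun_prop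
  convert ((hs.prod ht).prod (isCompact_Icc (a := (0 : ℝ)) (b := 1))).image hc
  ext x
  simp only [mem_convexJoin, segment_eq_image, Set.mem_image, Set.mem_prod, Prod.exists]
  constructor
  · rintro ⟨a, ha, b, hb, t, ht, rfl⟩
    exact ⟨a, b, t, ⟨⟨ha, hb⟩, ht⟩, rfl⟩
  · rintro ⟨a, b, t, ⟨⟨ha, hb⟩, ht⟩, rfl⟩
    exact ⟨a, ha, b, hb, t, ht, rfl⟩

theorem coe_convexCombination_lt {s₁ s₂ t : ℝ} {x₁ x₂ : EReal} (ht₀ : 0 ≤ t) (ht₁ : t ≤ 1)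
    (h₁ : (s₁ : EReal) < x₁) (h₂ : (s₂ : EReal) < x₂) :
    (((1 - t) * s₁ + t * s₂ : ℝ) : EReal) < ((1 - t : ℝ) : EReal) * x₁ + (t : EReal) * x₂ := by
  rcases ht₀.eq_or_lt with rfl | ht₀
  · simpa using h₁
  rcases ht₁.eq_or_lt with rfl | ht₁
  · simpa using h₂
  have ht : 0 < 1 - t := sub_pos.2 ht₁
  induction x₁ with
  | bot => simp at h₁
  | top =>
    rw [EReal.coe_mul_top_of_pos ht]
    induction x₂ with
    | bot => simp at h₂
    | top => rw [EReal.coe_mul_top_of_pos ht₀]; exact EReal.coe_lt_top _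
    | coe y => rw [← EReal.coe_mul, EReal.top_add_coe]; exact EReal.coe_lt_top _
  | coe x =>
    induction x₂ with
    | bot => simp at h₂
    | top =>
      rw [EReal.coe_mul_top_of_pos ht₀, ← EReal.coe_mul, EReal.coe_add_top]
      exact EReal.coe_lt_top _
    | coe y =>
      norm_cast at h₁ h₂ ⊢
      nlinarith

instance {V : Type*} [NormedAddCommGroup V] [NormedSpace ℝ V] :
    LocallyConvexSpace ℝ (WeakDual ℝ V) :=
  inferInstanceAs (LocallyConvexSpace ℝ (WeakBilin (topDualPairing ℝ V)))

section Separation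

variable {V : Type*} [NormedAddCommGroup V] [NormedSpace ℝ V] {K : Set (WeakDual ℝ V)}

theorem exists_eval_eq (f : StrongDual ℝ (WeakDual ℝ V × ℝ)) :
    ∃ (x : V) (c : ℝ), ∀ (ρ : WeakDual ℝ V) (s : ℝ), f (ρ, s) = ρ x + c * s := by
  obtain ⟨x, hx⟩ := LinearMap.dualEmbedding_surjective (topDualPairing ℝ V)
    (f.comp (ContinuousLinearMap.inl ℝ (WeakDual ℝ V) ℝ))
  refine ⟨x, f (0, 1), fun ρ s => ?_⟩
  have h₁ : f (ρ, 0) = ρ x := (DFunLike.congr_fun hx ρ).symm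
  have h₂ : ((ρ, s) : WeakDual ℝ V × ℝ) = (ρ, 0) + s • (0, 1) := by simp
  rw [h₂, map_add, map_smul, h₁, smul_eq_mul, mul_comm]

/-- The epigraph over `K`, with real heights, of an extended-real-valued function. -/
def epigraphOn (K : Set (WeakDual ℝ V)) (h : WeakDual ℝ V → EReal) : Set (WeakDual ℝ V × ℝ) :=
  {p | p.1 ∈ K ∧ h p.1 ≤ p.2}

theorem isClosed_epigraphOn {h : WeakDual ℝ V → EReal} (hK : IsClosed K)
    (hh : LowerSemicontinuousOn h K) : IsClosed (epigraphOn K h) :=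
  ((lowerSemicontinuousOn_iff_isClosed_epigraph hK).1 hh).preimage
    (continuous_fst.prodMk (continuous_coe_real_ereal.comp continuous_snd))

theorem convex_epigraphOn {h : WeakDual ℝ V → EReal} (hK : Convex ℝ K)
    (hbot : ∀ σ ∈ K, h σ ≠ ⊥) (hh : AffineOnKE K h) : Convex ℝ (epigraphOn K h) := by
  rintro ⟨ρ, r⟩ ⟨hρ, hr⟩ ⟨σ, s⟩ ⟨hσ, hs⟩ a b ha hb hab
  refine ⟨hK hρ hσ ha hb hab, ?_⟩
  obtain rfl : a = 1 - b := by linarith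
  dsimp only at hρ hr hσ hs
  simp only [Prod.smul_mk, Prod.mk_add_mk, smul_eq_mul]
  rw [hh ρ hρ σ hσ b hb (by linarith)]
  lift h ρ to ℝ using ⟨ne_top_of_le_ne_top (EReal.coe_ne_top _) hr, hbot ρ hρ⟩ with x
  lift h σ to ℝ using ⟨ne_top_of_le_ne_top (EReal.coe_ne_top _) hs, hbot σ hσ⟩ with y
  norm_cast at hr hs ⊢
  gcongr

/-- Two compact convex sets lying strictly below an affine lower semicontinuous function can be
separated from it by a single continuous affine function. -/
theorem exists_continuous_affine_between {v : V} (hKconv : Convex ℝ K) (hKclosed : IsClosed K)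
    (hv : ∀ σ ∈ K, σ v = 1) {h : WeakDual ℝ V → EReal} (hbot : ∀ σ ∈ K, h σ ≠ ⊥)
    (haff : AffineOnKE K h) (hlsc : LowerSemicontinuousOn h K)
    {S₁ S₂ : Set (WeakDual ℝ V × ℝ)} (hc₁ : IsCompact S₁) (hc₂ : IsCompact S₂)
    (hconv₁ : Convex ℝ S₁) (hconv₂ : Convex ℝ S₂) (hne : S₂.Nonempty)
    (hS₁ : ∀ p ∈ S₁, p.1 ∈ K ∧ (p.2 : EReal) < h p.1)
    (hS₂ : ∀ p ∈ S₂, p.1 ∈ K ∧ (p.2 : EReal) < h p.1) (hproj : ∀ σ ∈ K, ∃ s, (σ, s) ∈ S₁) :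
    ∃ b : V, (∀ σ ∈ K, ((σ b : ℝ) : EReal) < h σ) ∧
      (∀ p ∈ S₁, p.2 < p.1 b) ∧ ∀ p ∈ S₂, p.2 < p.1 b := by
  rcases (epigraphOn K h).eq_empty_or_nonempty with hT | ⟨⟨τ, r⟩, hτ⟩
  · have htop : ∀ σ ∈ K, h σ = ⊤ := by
      intro σ hσ
      by_contra hne'
      have : (σ, (h σ).toReal) ∈ epigraphOn K h := ⟨hσ, EReal.le_coe_toReal hne'⟩
      simp [hT] at this
    obtain ⟨M, hM⟩ := ((hc₁.union hc₂).image continuous_snd).bddAbove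
    have hlt : ∀ p ∈ S₁ ∪ S₂, p.1 ∈ K → p.2 < p.1 ((M + 1) • v) := fun p hp hpK => by
      have := hM (Set.mem_image_of_mem _ hp)
      rw [map_smul, hv _ hpK, smul_eq_mul]
      linarith
    exact ⟨(M + 1) • v, fun σ hσ => by rw [htop σ hσ]; exact EReal.coe_lt_top _,
      fun p hp => hlt p (.inl hp) (hS₁ p hp).1, fun p hp => hlt p (.inr hp) (hS₂ p hp).1⟩
  have hS₁ne : S₁.Nonempty := (hproj τ hτ.1).elim fun s hs => ⟨_, hs⟩
  have hdisj : Disjoint (convexJoin ℝ S₁ S₂) (epigraphOn K h) := by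
    rw [Set.disjoint_left]
    rintro p hp ⟨-, hp'⟩
    obtain ⟨⟨ρ, x⟩, hρ, ⟨σ, y⟩, hσ, a, b, ha, hb, hab, rfl⟩ := mem_convexJoin.1 hp
    obtain rfl : a = 1 - b := by linarith
    simp only [Prod.smul_mk, Prod.mk_add_mk, smul_eq_mul] at hp'
    rw [haff ρ (hS₁ _ hρ).1 σ (hS₂ _ hσ).1 b hb (by linarith)] at hp'
    exact hp'.not_gt (coe_convexCombination_lt hb (by linarith) (hS₁ _ hρ).2 (hS₂ _ hσ).2)
  obtain ⟨f, u, w, hfu, huw, hfw⟩ := geometric_hahn_banach_compact_closed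
    (hconv₁.convexJoin hconv₂) (isCompact_convexJoin hc₁ hc₂)
    (convex_epigraphOn hKconv hbot haff) (isClosed_epigraphOn hKclosed hlsc) hdisj
  obtain ⟨x, c, hf⟩ := exists_eval_eq f
  have hc : 0 < c := by
    obtain ⟨s, hs⟩ := hproj τ hτ.1
    have h₁ := hfu _ (subset_convexJoin_left hne hs)
    have h₂ := hfw _ hτ
    rw [hf] at h₁ h₂
    have h₃ : s < r := EReal.coe_lt_coe_iff.1 ((hS₁ _ hs).2.trans_le hτ.2)
    by_contra! hc
    nlinarith
  have hb : ∀ σ ∈ K, σ (c⁻¹ • (u • v - x)) = c⁻¹ * (u - σ x) := fun σ hσ => by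
    simp [hv σ hσ]
  have hlt : ∀ p ∈ convexJoin ℝ S₁ S₂, p.1 ∈ K → p.2 < p.1 (c⁻¹ • (u • v - x)) := by
    rintro ⟨σ, s⟩ hp hσ
    have := hfu _ hp
    rw [hf] at this
    rw [hb σ hσ, lt_inv_mul_iff₀ hc]
    linarith
  refine ⟨c⁻¹ • (u • v - x), fun σ hσ => ?_,
    fun p hp => hlt p (subset_convexJoin_left hne hp) (hS₁ p hp).1,
    fun p hp => hlt p (subset_convexJoin_right hS₁ne hp) (hS₂ p hp).1⟩
  by_contra! hle
  have := hfw (σ, _) ⟨hσ, hle⟩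
  rw [hf, hb σ hσ, mul_inv_cancel_left₀ hc.ne'] at this
  linarith

end Separation

namespace IsOrderUnitSpace

variable {V : Type*} [NormedAddCommGroup V] [NormedSpace ℝ V] {P : Set V} {v : V}

theorem convex_cone (hV : IsOrderUnitSpace V P v) : Convex ℝ P :=
  fun x hx y hy a b ha hb _ => hV.add_mem _ (hV.smul_mem a ha x hx) _ (hV.smul_mem b hb y hy)

theorem nonempty_bounds (hV : IsOrderUnitSpace V P v) (x : V) :
    {r : ℝ | 0 ≤ r ∧ x + r • v ∈ P ∧ r • v - x ∈ P}.Nonempty := by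
  obtain ⟨r, hr, hx⟩ := hV.unit_order x
  obtain ⟨s, hs, hy⟩ := hV.unit_order (-x)
  refine ⟨r + s, by positivity, ?_, ?_⟩
  · convert hV.add_mem _ hy _ (hV.smul_mem r hr.le v hV.unit_mem) using 1
    module
  · convert hV.add_mem _ hx _ (hV.smul_mem s hs.le v hV.unit_mem) using 1
    module

theorem abs_apply_le_norm (hV : IsOrderUnitSpace V P v) {ρ : WeakDual ℝ V}
    (hρ : ρ ∈ stateSpace P v) (x : V) : |ρ x| ≤ ‖x‖ := by
  rw [hV.norm_eq]
  refine le_csInf (hV.nonempty_bounds x) ?_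
  rintro r ⟨-, h₁, h₂⟩
  have h₁ := hρ.1 _ h₁
  have h₂ := hρ.1 _ h₂
  simp only [map_add, map_sub, map_smul, hρ.2, smul_eq_mul, mul_one] at h₁ h₂
  exact abs_le.2 ⟨by linarith, by linarith⟩

theorem add_smul_unit_mem_of_norm_lt (hV : IsOrderUnitSpace V P v) {x : V} {r : ℝ}
    (hx : ‖x‖ < r) : x + r • v ∈ P := by
  rw [hV.norm_eq] at hx
  obtain ⟨s, ⟨-, hs, -⟩, hsr⟩ := exists_lt_of_csInf_lt (hV.nonempty_bounds x) hx
  convert hV.add_mem _ hs _ (hV.smul_mem (r - s) (sub_nonneg.2 hsr.le) v hV.unit_mem) using 1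
  module

theorem isClosed_cone (hV : IsOrderUnitSpace V P v) : IsClosed P := by
  refine isClosed_of_closure_subset fun x hx => ?_
  rw [← neg_neg x]
  refine hV.archimedean (-x) v fun r hr => ?_
  rcases hr.eq_or_lt with rfl | hr
  · simpa using hV.unit_mem
  obtain ⟨y, hy, hxy⟩ := Metric.mem_closure_iff.1 hx r⁻¹ (inv_pos.2 hr)
  rw [dist_eq_norm] at hxy
  have := hV.add_mem _ (hV.smul_mem r hr.le _ (hV.add_smul_unit_mem_of_norm_lt hxy)) _
    (hV.smul_mem r hr.le y hy)
  convert this using 1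
  rw [smul_add, smul_smul, mul_inv_cancel₀ hr.ne']
  module

theorem mem_cone_of_forall_state (hV : IsOrderUnitSpace V P v) {x : V}
    (hx : ∀ ρ ∈ stateSpace P v, 0 ≤ ρ x) : x ∈ P := by
  by_contra hxP
  obtain ⟨f, u, hfx, hfP⟩ :=
    geometric_hahn_banach_point_closed hV.convex_cone hV.isClosed_cone hxP
  have hu : u < 0 := by simpa using hfP 0 (by simpa using hV.smul_mem 0 le_rfl v hV.unit_mem)
  have hpos : ∀ y ∈ P, 0 ≤ f y := by
    intro y hy
    by_contra! hneg
    have := hfP _ (hV.smul_mem (u / f y) (div_nonneg_of_nonpos hu.le hneg.le) y hy)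
    rw [map_smul, smul_eq_mul, div_mul_cancel₀ _ hneg.ne] at this
    exact this.false
  have hfv : 0 < f v := by
    obtain ⟨r, hr, hrx⟩ := hV.unit_order (-x)
    have := hpos _ hrx
    simp only [map_sub, map_smul, map_neg, smul_eq_mul] at this
    exact pos_of_mul_pos_right (a := r) (by linarith) hr.le
  have := hx (StrongDual.toWeakDual ((f v)⁻¹ • f)) ⟨fun y hy => ?_, ?_⟩
  · simp only [StrongDual.toWeakDual_apply, _root_.smul_apply, smul_eq_mul] at this
    exact (mul_neg_of_pos_of_neg (inv_pos.2 hfv) (hfx.trans hu)).not_ge this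
  · exact mul_nonneg (inv_nonneg.2 hfv.le) (hpos y hy)
  · exact inv_mul_cancel₀ hfv.ne'

theorem isClosed_stateSpace (P : Set V) (v : V) : IsClosed (stateSpace P v) := by
  simp only [stateSpace, Set.ofPred_and, Set.ofPred_forall]
  exact (isClosed_biInter fun x _ =>
    isClosed_le continuous_const (WeakDual.eval_continuous x)).inter
    (isClosed_eq (WeakDual.eval_continuous v) continuous_const)

theorem convex_stateSpace (P : Set V) (v : V) : Convex ℝ (stateSpace P v) := by
  rintro ρ hρ σ hσ a b ha hb hab
  refine ⟨fun x hx => ?_, ?_⟩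
  · exact add_nonneg (mul_nonneg ha (hρ.1 x hx)) (mul_nonneg hb (hσ.1 x hx))
  · change a * ρ v + b * σ v = 1
    rw [hρ.2, hσ.2, mul_one, mul_one, hab]

theorem isCompact_stateSpace (hV : IsOrderUnitSpace V P v) : IsCompact (stateSpace P v) := by
  refine (WeakDual.isCompact_closedBall (0 : StrongDual ℝ V) 1).of_isClosed_subset
    (isClosed_stateSpace P v) fun ρ hρ => ?_
  rw [Set.mem_preimage, mem_closedBall_zero_iff]
  refine ContinuousLinearMap.opNorm_le_bound _ zero_le_one fun x => ?_
  rw [one_mul]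
  exact hV.abs_apply_le_norm hρ x

theorem mem_openCone_of_forall_state (hV : IsOrderUnitSpace V P v) {x : V}
    (hx : ∀ ρ ∈ stateSpace P v, 0 < ρ x) : x ∈ openCone P v := by
  rcases (stateSpace P v).eq_empty_or_nonempty with hK | hK
  · exact ⟨1, one_pos, hV.mem_cone_of_forall_state (by simp [hK])⟩
  obtain ⟨ρ, hρ, hmin⟩ := hV.isCompact_stateSpace.exists_isMinOn hK
    (WeakDual.eval_continuous x).continuousOn
  refine ⟨ρ x, hx ρ hρ, hV.mem_cone_of_forall_state fun σ hσ => ?_⟩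
  have : ρ x ≤ σ x := hmin hσ
  simpa [hσ.2] using this

theorem apply_pos_of_mem_openCone {x : V} (hx : x ∈ openCone P v) {ρ : WeakDual ℝ V}
    (hρ : ρ ∈ stateSpace P v) : 0 < ρ x := by
  obtain ⟨ε, hε, hx⟩ := hx
  have := hρ.1 _ hx
  simp only [map_sub, map_smul, hρ.2, smul_eq_mul, mul_one] at this
  linarith

/-- The graph of the affine function given by `a` on the state space. -/
def stateGraph (P : Set V) (v a : V) : Set (WeakDual ℝ V × ℝ) :=
  (fun σ : WeakDual ℝ V => (σ, σ a)) '' stateSpace P v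

theorem isCompact_stateGraph (hV : IsOrderUnitSpace V P v) (a : V) :
    IsCompact (stateGraph P v a) :=
  hV.isCompact_stateSpace.image (continuous_id.prodMk (WeakDual.eval_continuous a))

theorem convex_stateGraph (P : Set V) (v a : V) : Convex ℝ (stateGraph P v a) := by
  rintro _ ⟨ρ, hρ, rfl⟩ _ ⟨σ, hσ, rfl⟩ s t hs ht hst
  exact ⟨s • ρ + t • σ, convex_stateSpace P v hρ hσ hs ht hst, rfl⟩

variable {h : WeakDual ℝ V → EReal}

theorem exists_above_pair_below (hV : IsOrderUnitSpace V P v)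
    (hbot : ∀ σ ∈ stateSpace P v, h σ ≠ ⊥) (haff : AffineOnKE (stateSpace P v) h)
    (hlsc : LowerSemicontinuousOn h (stateSpace P v)) {b₁ b₂ : V}
    (h₁ : ∀ σ ∈ stateSpace P v, ((σ b₁ : ℝ) : EReal) < h σ)
    (h₂ : ∀ σ ∈ stateSpace P v, ((σ b₂ : ℝ) : EReal) < h σ) :
    ∃ b : V, ∀ σ ∈ stateSpace P v, ((σ b : ℝ) : EReal) < h σ ∧ σ b₁ < σ b ∧ σ b₂ < σ b := by
  rcases (stateSpace P v).eq_empty_or_nonempty with hK | hK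
  · exact ⟨0, by simp [hK]⟩
  obtain ⟨b, hb, hb₁, hb₂⟩ := exists_continuous_affine_between (convex_stateSpace P v)
    (isClosed_stateSpace P v) (fun σ hσ => hσ.2) hbot haff hlsc (hV.isCompact_stateGraph b₁)
    (hV.isCompact_stateGraph b₂) (convex_stateGraph P v b₁) (convex_stateGraph P v b₂)
    (hK.image _) (by rintro _ ⟨σ, hσ, rfl⟩; exact ⟨hσ, h₁ σ hσ⟩)
    (by rintro _ ⟨σ, hσ, rfl⟩; exact ⟨hσ, h₂ σ hσ⟩) (fun σ hσ => ⟨_, σ, hσ, rfl⟩)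
  exact ⟨b, fun σ hσ => ⟨hb σ hσ, hb₁ _ ⟨σ, hσ, rfl⟩, hb₂ _ ⟨σ, hσ, rfl⟩⟩⟩

theorem exists_above_point_below (hV : IsOrderUnitSpace V P v)
    (hbot : ∀ σ ∈ stateSpace P v, h σ ≠ ⊥) (haff : AffineOnKE (stateSpace P v) h)
    (hlsc : LowerSemicontinuousOn h (stateSpace P v)) {b₀ : V}
    (h₀ : ∀ σ ∈ stateSpace P v, ((σ b₀ : ℝ) : EReal) < h σ) {ρ : WeakDual ℝ V}
    (hρ : ρ ∈ stateSpace P v) {r : ℝ} (hr : (r : EReal) < h ρ) :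
    ∃ b : V, (∀ σ ∈ stateSpace P v, ((σ b : ℝ) : EReal) < h σ ∧ σ b₀ < σ b) ∧ r < ρ b := by
  obtain ⟨b, hb, hb₁, hb₂⟩ := exists_continuous_affine_between (convex_stateSpace P v)
    (isClosed_stateSpace P v) (fun σ hσ => hσ.2) hbot haff hlsc (hV.isCompact_stateGraph b₀)
    (isCompact_singleton (x := (ρ, r))) (convex_stateGraph P v b₀) (convex_singleton _)
    (Set.singleton_nonempty _) (by rintro _ ⟨σ, hσ, rfl⟩; exact ⟨hσ, h₀ σ hσ⟩)
    (by rintro _ rfl; exact ⟨hρ, hr⟩) (fun σ hσ => ⟨_, σ, hσ, rfl⟩)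
  exact ⟨b, fun σ hσ => ⟨hb σ hσ, hb₁ _ ⟨σ, hσ, rfl⟩⟩, hb₂ _ rfl⟩

end IsOrderUnitSpace

/-- Let `K` be the state space of a nonzero complete order unit space
`(V, P, v)`. (1) For every affine upper semicontinuous `g : K → [0,∞)`, the set
`𝔄 = {a ∈ C : a > g on K}` is downward directed and `g(ρ) = inf {a(ρ) : a ∈ 𝔄}` on `K`.
(2) For every affine lower semicontinuous `h : K → (0,∞]`, the set
`𝔅 = {b ∈ C : b < h on K}` is upward directed and `h(ρ) = sup {b(ρ) : b ∈ 𝔅}` on `K`. -/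
theorem semicontinuous_affine_approximation
    {V : Type*} [NormedAddCommGroup V] [NormedSpace ℝ V] [CompleteSpace V] [Nontrivial V]
    (P : Set V) (v : V) (hV : IsOrderUnitSpace V P v) :
    (∀ g : WeakDual ℝ V → ℝ,
      (∀ ρ ∈ stateSpace P v, 0 ≤ g ρ) →
      AffineOnK (stateSpace P v) g →
      UpperSemicontinuousOn g (stateSpace P v) →
      (∀ a₁ ∈ approxFromAbove P v g, ∀ a₂ ∈ approxFromAbove P v g,
        ∃ a ∈ approxFromAbove P v g, a₁ - a ∈ P ∧ a₂ - a ∈ P) ∧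
      (∀ ρ ∈ stateSpace P v,
        g ρ = sInf ((fun a : V => ρ a) '' approxFromAbove P v g))) ∧
    (∀ h : WeakDual ℝ V → EReal,
      (∀ ρ ∈ stateSpace P v, 0 < h ρ) →
      AffineOnKE (stateSpace P v) h →
      LowerSemicontinuousOn h (stateSpace P v) →
      (∀ b₁ ∈ approxFromBelow P v h, ∀ b₂ ∈ approxFromBelow P v h,
        ∃ b ∈ approxFromBelow P v h, b - b₁ ∈ P ∧ b - b₂ ∈ P) ∧
      (∀ ρ ∈ stateSpace P v,
        h ρ = sSup ((fun b : V => ((ρ b : ℝ) : EReal)) '' approxFromBelow P v h))) := by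
  refine ⟨fun g hg₀ hgaff hgusc => ?_, fun h hpos haff hlsc => ?_⟩
  · have hbot : ∀ σ ∈ stateSpace P v, ((-g σ : ℝ) : EReal) ≠ ⊥ := fun σ _ => EReal.coe_ne_bot _
    have haff : AffineOnKE (stateSpace P v) fun σ => ((-g σ : ℝ) : EReal) := by
      intro ρ hρ σ hσ t ht₀ ht₁
      dsimp only
      rw [hgaff ρ hρ σ hσ t ht₀ ht₁, ← EReal.coe_mul, ← EReal.coe_mul, ← EReal.coe_add]
      congr 1
      ring
    have hlsc : LowerSemicontinuousOn (fun σ => ((-g σ : ℝ) : EReal)) (stateSpace P v) :=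
      continuous_coe_real_ereal.comp_lowerSemicontinuousOn
        (continuous_neg.comp_upperSemicontinuousOn_antitone hgusc fun _ _ => neg_le_neg)
        EReal.coe_strictMono.monotone
    have hmem : ∀ b : V, (∀ σ ∈ stateSpace P v, ((σ b : ℝ) : EReal) < ((-g σ : ℝ) : EReal)) →
        -b ∈ approxFromAbove P v g := fun b hb => by
      have hlt : ∀ σ ∈ stateSpace P v, g σ < σ (-b) := fun σ hσ => by
        rw [map_neg]
        linarith [EReal.coe_lt_coe_iff.1 (hb σ hσ)]
      exact ⟨hV.mem_openCone_of_forall_state fun σ hσ => (hg₀ σ hσ).trans_lt (hlt σ hσ), hlt⟩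
    have hneg : ∀ a ∈ approxFromAbove P v g, ∀ σ ∈ stateSpace P v,
        ((σ (-a) : ℝ) : EReal) < ((-g σ : ℝ) : EReal) := fun a ha σ hσ => by
      rw [map_neg]
      exact EReal.coe_lt_coe_iff.2 (neg_lt_neg (ha.2 σ hσ))
    refine ⟨fun a₁ ha₁ a₂ ha₂ => ?_, fun ρ hρ => ?_⟩
    · obtain ⟨b, hb⟩ := hV.exists_above_pair_below hbot haff hlsc (hneg a₁ ha₁) (hneg a₂ ha₂)
      refine ⟨-b, hmem b fun σ hσ => (hb σ hσ).1,
        hV.mem_cone_of_forall_state fun σ hσ => ?_, hV.mem_cone_of_forall_state fun σ hσ => ?_⟩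
      all_goals
        have := hb σ hσ
        simp only [map_sub, map_neg] at this ⊢
        linarith
    · obtain ⟨M, hM⟩ := hgusc.bddAbove_of_isCompact hV.isCompact_stateSpace
      have h₀ : ∀ σ ∈ stateSpace P v,
          ((σ (-(M + 1) • v) : ℝ) : EReal) < ((-g σ : ℝ) : EReal) := fun σ hσ => by
        rw [map_smul, hσ.2, smul_eq_mul, EReal.coe_lt_coe_iff]
        linarith [hM (Set.mem_image_of_mem g hσ)]
      refine (csInf_eq_of_forall_ge_of_forall_gt_exists_lt ?_ ?_ fun r hr => ?_).symm
      · exact Set.Nonempty.image _ ⟨_, hmem _ h₀⟩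
      · rintro _ ⟨a, ha, rfl⟩
        exact (ha.2 ρ hρ).le
      · obtain ⟨b, hb, hbr⟩ := hV.exists_above_point_below hbot haff hlsc h₀ hρ
          (EReal.coe_lt_coe_iff.2 (neg_lt_neg hr))
        refine ⟨_, ⟨-b, hmem b fun σ hσ => (hb σ hσ).1, rfl⟩, ?_⟩
        simp only [map_neg]
        linarith
  · have hbot : ∀ σ ∈ stateSpace P v, h σ ≠ ⊥ := fun σ hσ =>
      (EReal.bot_lt_zero.trans (hpos σ hσ)).ne'
    refine ⟨fun b₁ hb₁ b₂ hb₂ => ?_, fun ρ hρ => ?_⟩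
    · obtain ⟨b, hb⟩ := hV.exists_above_pair_below hbot haff hlsc hb₁.2 hb₂.2
      refine ⟨b, ⟨hV.mem_openCone_of_forall_state fun σ hσ =>
          (IsOrderUnitSpace.apply_pos_of_mem_openCone hb₁.1 hσ).trans (hb σ hσ).2.1,
          fun σ hσ => (hb σ hσ).1⟩,
        hV.mem_cone_of_forall_state fun σ hσ => ?_, hV.mem_cone_of_forall_state fun σ hσ => ?_⟩
      · simpa using (hb σ hσ).2.1.le
      · simpa using (hb σ hσ).2.2.le
    · refine le_antisymm (EReal.ge_of_forall_gt_iff_ge.1 fun r hr => ?_) (sSup_le ?_)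
      · obtain ⟨b, hb, hbr⟩ := hV.exists_above_point_below hbot haff hlsc (b₀ := 0)
          (fun σ hσ => by simpa using hpos σ hσ) hρ hr
        refine (EReal.coe_le_coe_iff.2 hbr.le).trans
          (le_sSup ⟨b, ⟨?_, fun σ hσ => (hb σ hσ).1⟩, rfl⟩)
        exact hV.mem_openCone_of_forall_state fun σ hσ => by simpa using (hb σ hσ).2
      · rintro _ ⟨b, hb, rfl⟩
        exact (hb.2 ρ hρ).le
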